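/- For every $q\in\mathbb{R}$ and every $\varepsilon>0$, for $\nu_q$-almost every $x\in[0,1]$ there exists $r_x>0$ such that $\nu_q(B(x,r))\le\nu(B(x,r))^q\,r^{\underline{\tau}_\mu(q)-\varepsilon}$ for all $0<r<r_x$. -/

import Mathlib

open MeasureTheory Metric Set Filter Topology Classical
open scoped ENNReal NNReal

noncomputable section

namespace MF

/-! ### Olsen's multifractal measures and dimension functions on a metric space -/

variable {X : Type} [MetricSpace X]

/-- The sum `∑ m(B(xᵢ,rᵢ))^q (2rᵢ)^t` associated with a countable family of centered balls. -/
def olsenSum [MeasurableSpace X] (m : Measure X) (q t : ℝ) {ι : Type}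
    (c : ι → X) (r : ι → ℝ) : ℝ≥0∞ :=
  ∑' i, m (closedBall (c i) (r i)) ^ q * ENNReal.ofReal (2 * r i) ^ t

/-- `Olsen's 𝓗^{q,t}_{m,δ}`: infimum over countable centered `δ`-coverings of `E`. -/
def Hdel [MeasurableSpace X] (m : Measure X) (q t δ : ℝ) (E : Set X) : ℝ≥0∞ :=
  ⨅ (ι : Type) (_ : Countable ι) (c : ι → X) (r : ι → ℝ)
    (_ : ∀ i, c i ∈ E) (_ : ∀ i, 0 < r i ∧ r i ≤ δ)
    (_ : E ⊆ ⋃ i, closedBall (c i) (r i)), olsenSum m q t c r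

/-- Olsen's premeasure `𝓗̄^{q,t}_m` (limit, i.e. supremum, as `δ ↓ 0`). -/
def Hpre [MeasurableSpace X] (m : Measure X) (q t : ℝ) (E : Set X) : ℝ≥0∞ :=
  ⨆ (δ : ℝ) (_ : 0 < δ), Hdel m q t δ E

/-- Olsen's multifractal Hausdorff measure `𝓗^{q,t}_m`. -/
def Hmeas [MeasurableSpace X] (m : Measure X) (q t : ℝ) (E : Set X) : ℝ≥0∞ :=
  ⨆ (F : Set X) (_ : F ⊆ E), Hpre m q t F

/-- `𝓟̄^{q,t}_{m,δ}`: supremum over countable centered `δ`-packings of `E`. -/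
def Pdel [MeasurableSpace X] (m : Measure X) (q t δ : ℝ) (E : Set X) : ℝ≥0∞ :=
  ⨆ (ι : Type) (_ : Countable ι) (c : ι → X) (r : ι → ℝ)
    (_ : ∀ i, c i ∈ E) (_ : ∀ i, 0 < r i ∧ r i ≤ δ)
    (_ : ∀ i j, i ≠ j → Disjoint (closedBall (c i) (r i)) (closedBall (c j) (r j))),
    olsenSum m q t c r

/-- Olsen's packing premeasure `𝓟̄^{q,t}_m` (limit, i.e. infimum, as `δ ↓ 0`). -/
def Ppre [MeasurableSpace X] (m : Measure X) (q t : ℝ) (E : Set X) : ℝ≥0∞ :=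
  ⨅ (δ : ℝ) (_ : 0 < δ), Pdel m q t δ E

/-- Olsen's multifractal packing measure `𝓟^{q,t}_m`. -/
def Pmeas [MeasurableSpace X] (m : Measure X) (q t : ℝ) (E : Set X) : ℝ≥0∞ :=
  ⨅ (En : ℕ → Set X) (_ : E ⊆ ⋃ n, En n), ∑' n, Ppre m q t (En n)

/-- The (topological) support of a measure on a metric space. -/
def msupport [MeasurableSpace X] (m : Measure X) : Set X :=
  {x | ∀ r : ℝ, 0 < r → 0 < m (ball x r)}

/-- Olsen's multifractal Hausdorff dimension function `b_m`. -/
def bFun [MeasurableSpace X] (m : Measure X) (q : ℝ) : ℝ :=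
  sInf {t | Hmeas m q t (msupport m) = 0}

/-- Olsen's multifractal packing dimension function `B_m`. -/
def BFun [MeasurableSpace X] (m : Measure X) (q : ℝ) : ℝ :=
  sInf {t | Pmeas m q t (msupport m) = 0}

/-- Olsen's function `τ_m`. -/
def tauFun [MeasurableSpace X] (m : Measure X) (q : ℝ) : ℝ :=
  sInf {t | Ppre m q t (msupport m) = 0}

/-- `t`-dimensional packing pre-premeasure at scale `δ`. -/
def pPdel (t δ : ℝ) (E : Set X) : ℝ≥0∞ :=
  ⨆ (ι : Type) (_ : Countable ι) (c : ι → X) (r : ι → ℝ)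
    (_ : ∀ i, c i ∈ E) (_ : ∀ i, 0 < r i ∧ r i ≤ δ)
    (_ : ∀ i j, i ≠ j → Disjoint (closedBall (c i) (r i)) (closedBall (c j) (r j))),
    ∑' i, ENNReal.ofReal (2 * r i) ^ t

/-- `t`-dimensional packing premeasure. -/
def pPpre (t : ℝ) (E : Set X) : ℝ≥0∞ := ⨅ (δ : ℝ) (_ : 0 < δ), pPdel t δ E

/-- `t`-dimensional packing measure. -/
def pPmeas (t : ℝ) (E : Set X) : ℝ≥0∞ :=
  ⨅ (En : ℕ → Set X) (_ : E ⊆ ⋃ n, En n), ∑' n, pPpre t (En n)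

/-- Packing dimension of a set. -/
def packDim (E : Set X) : ℝ := sInf {t | pPmeas t E = 0}

/-- The level set `X_m(α)` of points of the support where the local Hölder exponent is `α`. -/
def Xlev [MeasurableSpace X] (m : Measure X) (α : ℝ) : Set X :=
  {x | x ∈ msupport m ∧
    Tendsto (fun r => Real.log (m (closedBall x r)).toReal / Real.log r)
      (𝓝[>] (0 : ℝ)) (𝓝 α)}

/-- Legendre transform `f^*(x) = inf_y (xy + f(y))`. -/
def leg (f : ℝ → ℝ) (x : ℝ) : ℝ := ⨅ y : ℝ, (x * y + f y)

/-! ### The mixed symbolic space and inhomogeneous multinomial measures -/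

/-- `j` is an index governed by the first alphabet:
`T (2k-1) ≤ j < T (2k)` for some `k ≥ 1`. -/
def isA (T : ℕ → ℕ) (j : ℕ) : Prop :=
  ∃ k, 1 ≤ k ∧ T (2 * k - 1) ≤ j ∧ j < T (2 * k)

/-- The size of the alphabet at (0-based) position `n`, i.e. at paper index `j = n+1`. -/
def Yc (c₁ c₂ : ℕ) (T : ℕ → ℕ) (n : ℕ) : ℕ := if isA T (n + 1) then c₁ else c₂

/-- The mixed symbolic space `∂𝒜₁,₂* = ∏ⱼ Yⱼ`. -/
abbrev Omg (c₁ c₂ : ℕ) (T : ℕ → ℕ) : Type := ∀ n : ℕ, Fin (Yc c₁ c₂ T n)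

/-- Finite words of length `n`. -/
abbrev Word (c₁ c₂ : ℕ) (T : ℕ → ℕ) (n : ℕ) : Type :=
  ∀ i : Fin n, Fin (Yc c₁ c₂ T i.val)

/-- `N_n`: the number of indices `1 ≤ j ≤ n` governed by the first alphabet. -/
def Ncount (T : ℕ → ℕ) (n : ℕ) : ℕ := ((Finset.Icc 1 n).filter (isA T)).card

/-- Diameter `c₁^{-N_n} c₂^{-(n-N_n)}` of a cylinder of generation `n`. -/
def Dw (c₁ c₂ : ℕ) (T : ℕ → ℕ) (n : ℕ) : ℝ :=
  ((c₁ : ℝ) ^ Ncount T n * (c₂ : ℝ) ^ (n - Ncount T n))⁻¹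

/-- The cylinder `[w]` defined by a finite word `w`. -/
def cyl (c₁ c₂ : ℕ) (T : ℕ → ℕ) (n : ℕ) (w : Word c₁ c₂ T n) : Set (Omg c₁ c₂ T) :=
  {x | ∀ i : Fin n, x i.val = w i}

/-- The mass `∏_{j≤n} p_j` given to the cylinder `[w]` by the inhomogeneous
multinomial measure with weights `a` and `b`. -/
def cylWeight (c₁ c₂ : ℕ) (T : ℕ → ℕ) (a b : ℕ → ℝ) (n : ℕ) (w : Word c₁ c₂ T n) : ℝ :=
  ∏ i : Fin n, (if isA T (i.val + 1) then a (w i).val else b (w i).val)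

/-- `θ(q) = log_c (p₁^q + ⋯ + p_c^q)`. -/
def theta (c : ℕ) (p : ℕ → ℝ) (q : ℝ) : ℝ :=
  Real.logb c (∑ i ∈ Finset.range c, p i ^ q)

/-- `τ_{μ,n}(q)`, defined by `∑_{z ∈ 𝒜₁,₂ⁿ} μ([z])^q = |w|^{-τ_{μ,n}(q)}`. -/
def tauN (c₁ c₂ : ℕ) (T : ℕ → ℕ) (a b : ℕ → ℝ) (q : ℝ) (n : ℕ) : ℝ :=
  Real.log (∑ z : Word c₁ c₂ T n, cylWeight c₁ c₂ T a b n z ^ q) /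
    Real.log ((c₁ : ℝ) ^ Ncount T n * (c₂ : ℝ) ^ (n - Ncount T n))

/-- The natural projection `γ : ∂𝒜₁,₂* → [0,1]`,
`γ(ε₁ε₂⋯) = ∑_{n≥1} εₙ c₁^{-N_n} c₂^{-(n-N_n)}`. -/
def gammaMap (c₁ c₂ : ℕ) (T : ℕ → ℕ) (x : Omg c₁ c₂ T) : ℝ :=
  ∑' n : ℕ, ((x n).val : ℝ) * Dw c₁ c₂ T (n + 1)

/-- The normalized weights `pᵢ^q / (p₁^q + ⋯ + p_c^q)`. -/
def taW (c : ℕ) (p : ℕ → ℝ) (q : ℝ) (i : ℕ) : ℝ :=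
  p i ^ q / ∑ j ∈ Finset.range c, p j ^ q

/-- `s₁ = min{max aᵢ, max bⱼ}`. -/
def sOne (c₁ c₂ : ℕ) (a b : ℕ → ℝ) : ℝ :=
  min (sSup {x | ∃ i < c₁, a i = x}) (sSup {x | ∃ j < c₂, b j = x})

/-- `s₂ = max{min aᵢ, min bⱼ}`. -/
def sTwo (c₁ c₂ : ℕ) (a b : ℕ → ℝ) : ℝ :=
  max (sInf {x | ∃ i < c₁, a i = x}) (sInf {x | ∃ j < c₂, b j = x})

/-- Entropy `h(p) = -∑_{i<2} pᵢ log₂ pᵢ`. -/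
def hEnt (p : ℕ → ℝ) : ℝ := -(∑ i ∈ Finset.range 2, p i * Real.logb 2 (p i))

/-! ### Dyadic intervals -/

/-- The family `𝓕_n` of dyadic intervals of generation `n` in `[0,1]`. -/
def Fnfam (n : ℕ) : Set (Set ℝ) :=
  {I | ∃ j : ℕ, j < 2 ^ n ∧ I = Set.Icc ((j : ℝ) / 2 ^ n) (((j : ℝ) + 1) / 2 ^ n)}

/-- Index of the dyadic interval of generation `n` containing `x`
(the left one when `x` is dyadic). -/
def dyadIdx (n : ℕ) (x : ℝ) : ℤ := ⌈x * 2 ^ n⌉ - 1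

/-- `I_n(x)`: the dyadic interval of generation `n` containing `x`
(the left one when `x` is dyadic). -/
def Idyad (n : ℕ) (x : ℝ) : Set ℝ :=
  Set.Icc ((dyadIdx n x : ℝ) / 2 ^ n) (((dyadIdx n x : ℝ) + 1) / 2 ^ n)

/-- `I_n(x)⁺`: the right neighbour of `I_n(x)` in `𝓕_n`. -/
def IdyadP (n : ℕ) (x : ℝ) : Set ℝ :=
  Set.Icc (((dyadIdx n x : ℝ) + 1) / 2 ^ n) (((dyadIdx n x : ℝ) + 2) / 2 ^ n)

/-- `I_n(x)⁻`: the left neighbour of `I_n(x)` in `𝓕_n`. -/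
def IdyadM (n : ℕ) (x : ℝ) : Set ℝ :=
  Set.Icc (((dyadIdx n x : ℝ) - 1) / 2 ^ n) ((dyadIdx n x : ℝ) / 2 ^ n)

/-! ### Expansions of real numbers in a mixed base -/

/-- The length of a cell of generation `n` for the mixed base `Y`. -/
def cellLength (Y : ℕ → ℕ) (n : ℕ) : ℝ := ∏ k ∈ Finset.range n, (Y k : ℝ)⁻¹

/-- The real number whose digits in the mixed base `Y` are `x`. -/
def ofMixedDigits (Y : ℕ → ℕ) (x : ∀ n, Fin (Y n)) : ℝ :=
  ∑' n : ℕ, ((x n).val : ℝ) * cellLength Y (n + 1)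

/-- The contribution of the digits of index at least `n`. -/
def mixedTail (Y : ℕ → ℕ) (n : ℕ) (x : ∀ n, Fin (Y n)) : ℝ :=
  ∑' k : ℕ, ((x (k + n)).val : ℝ) * cellLength Y (k + n + 1)

/-- The integer formed by the first `n` digits. -/
def prefixNat (Y : ℕ → ℕ) (x : ∀ n, Fin (Y n)) : ℕ → ℕ
  | 0 => 0
  | n + 1 => prefixNat Y x n * Y n + (x n).val

/-- The sequences with the same first `n` terms as `x`. -/
def cylAt {Y : ℕ → ℕ} (n : ℕ) (x : ∀ n, Fin (Y n)) : Set (∀ n, Fin (Y n)) :=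
  {y | ∀ k < n, y k = x k}

section MixedBase

variable {Y : ℕ → ℕ}

theorem cellLength_succ (n : ℕ) : cellLength Y (n + 1) = cellLength Y n * (Y n : ℝ)⁻¹ :=
  Finset.prod_range_succ _ _

theorem cellLength_pos (hY : ∀ n, 2 ≤ Y n) (n : ℕ) : 0 < cellLength Y n :=
  Finset.prod_pos fun k _ => inv_pos.2 (by exact_mod_cast lt_of_lt_of_le two_pos (hY k))

theorem cellLength_succ_mul (hY : ∀ n, 2 ≤ Y n) (n : ℕ) :
    (Y n : ℝ) * cellLength Y (n + 1) = cellLength Y n := by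
  have : (Y n : ℝ) ≠ 0 := by exact_mod_cast (lt_of_lt_of_le two_pos (hY n)).ne'
  rw [cellLength_succ]
  field_simp

theorem cellLength_le_half_pow (hY : ∀ n, 2 ≤ Y n) (n : ℕ) :
    cellLength Y n ≤ (1 / 2 : ℝ) ^ n := by
  have : ∏ _k ∈ Finset.range n, (1 / 2 : ℝ) = (1 / 2 : ℝ) ^ n := by simp
  rw [← this]
  refine Finset.prod_le_prod (fun k _ => by positivity) fun k _ => ?_
  rw [one_div]
  exact inv_anti₀ two_pos (by exact_mod_cast hY k)

theorem cellLength_antitone (hY : ∀ n, 2 ≤ Y n) : Antitone (cellLength Y) := by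
  refine antitone_nat_of_succ_le fun n => ?_
  have h1 : (1 : ℝ) ≤ Y n := by exact_mod_cast one_le_two.trans (hY n)
  rw [← cellLength_succ_mul hY n]
  exact le_mul_of_one_le_left (cellLength_pos hY _).le h1

theorem tendsto_cellLength (hY : ∀ n, 2 ≤ Y n) : Tendsto (cellLength Y) atTop (𝓝 0) :=
  squeeze_zero (fun n => (cellLength_pos hY n).le) (cellLength_le_half_pow hY)
    (tendsto_pow_atTop_nhds_zero_of_lt_one (by norm_num) (by norm_num))

/-- A cell of generation `n` is at most `M ^ l` times as long as one of generation `n + l`. -/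
theorem cellLength_le_pow_mul (hY : ∀ n, 2 ≤ Y n) {M : ℝ} (hM : ∀ n, (Y n : ℝ) ≤ M)
    (n l : ℕ) : cellLength Y n ≤ M ^ l * cellLength Y (n + l) := by
  have hM0 : 0 ≤ M := (Nat.cast_nonneg _).trans (hM 0)
  induction l with
  | zero => simp
  | succ l ih =>
    refine ih.trans ?_
    rw [pow_succ, mul_assoc, ← add_assoc, ← cellLength_succ_mul hY (n + l)]
    have := (cellLength_pos hY (n + l + 1)).le
    gcongr
    exact hM _

theorem hasSum_max_digits (hY : ∀ n, 2 ≤ Y n) (n : ℕ) :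
    HasSum (fun k => ((Y (k + n) : ℝ) - 1) * cellLength Y (k + n + 1)) (cellLength Y n) := by
  have hterm : ∀ k, ((Y (k + n) : ℝ) - 1) * cellLength Y (k + n + 1) =
      cellLength Y (k + n) - cellLength Y (k + 1 + n) := fun k => by
    rw [sub_mul, cellLength_succ_mul hY, one_mul, add_right_comm k 1 n]
  simp only [hterm]
  rw [hasSum_iff_tendsto_nat_of_nonneg
    (fun k => sub_nonneg.2 (cellLength_antitone hY (by omega)))]
  simp only [Finset.sum_range_sub' (fun k => cellLength Y (k + n)), zero_add]
  simpa using ((tendsto_cellLength hY).comp (tendsto_add_atTop_nat n)).const_sub (cellLength Y n)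

theorem digit_le (x : ∀ n, Fin (Y n)) (k : ℕ) : ((x k).val : ℝ) ≤ (Y k : ℝ) - 1 := by
  have : (x k).val + 1 ≤ Y k := (x k).isLt
  have : ((x k).val : ℝ) + 1 ≤ Y k := by exact_mod_cast this
  linarith

theorem summable_digits (hY : ∀ n, 2 ≤ Y n) (n : ℕ) (x : ∀ n, Fin (Y n)) :
    Summable (fun k => ((x (k + n)).val : ℝ) * cellLength Y (k + n + 1)) :=
  Summable.of_nonneg_of_le
    (fun _ => mul_nonneg (Nat.cast_nonneg _) (cellLength_pos hY _).le)
    (fun _ => mul_le_mul_of_nonneg_right (digit_le x _) (cellLength_pos hY _).le)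
    (hasSum_max_digits hY n).summable

theorem prefixNat_mul_cellLength (hY : ∀ n, 2 ≤ Y n) (x : ∀ n, Fin (Y n)) (n : ℕ) :
    ∑ k ∈ Finset.range n, ((x k).val : ℝ) * cellLength Y (k + 1) =
      prefixNat Y x n * cellLength Y n := by
  induction n with
  | zero => simp [prefixNat]
  | succ n ih =>
    rw [Finset.sum_range_succ, ih, prefixNat, ← cellLength_succ_mul hY n]
    push_cast
    ring

theorem ofMixedDigits_eq (hY : ∀ n, 2 ≤ Y n) (x : ∀ n, Fin (Y n)) (n : ℕ) :
    ofMixedDigits Y x = prefixNat Y x n * cellLength Y n + mixedTail Y n x := by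
  rw [← prefixNat_mul_cellLength hY]
  exact ((summable_digits hY 0 x).sum_add_tsum_nat_add n).symm

theorem mixedTail_nonneg (hY : ∀ n, 2 ≤ Y n) (n : ℕ) (x : ∀ n, Fin (Y n)) :
    0 ≤ mixedTail Y n x :=
  tsum_nonneg fun _ => mul_nonneg (Nat.cast_nonneg _) (cellLength_pos hY _).le

theorem mixedTail_le (hY : ∀ n, 2 ≤ Y n) (n : ℕ) (x : ∀ n, Fin (Y n)) :
    mixedTail Y n x ≤ cellLength Y n :=
  hasSum_le (fun _ => mul_le_mul_of_nonneg_right (digit_le x _) (cellLength_pos hY _).le)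
    (summable_digits hY n x).hasSum (hasSum_max_digits hY n)

theorem le_mixedTail (hY : ∀ n, 2 ≤ Y n) {n m k : ℕ} (x : ∀ n, Fin (Y n)) (hnk : n ≤ k)
    (hkm : k < m) (hx : (x k).val ≠ 0) : cellLength Y m ≤ mixedTail Y n x := by
  obtain ⟨j, rfl⟩ := Nat.exists_eq_add_of_le' hnk
  refine (cellLength_antitone hY (Nat.succ_le_of_lt hkm)).trans ?_
  refine le_trans ?_ ((summable_digits hY n x).le_tsum j
    fun _ _ => mul_nonneg (Nat.cast_nonneg _) (cellLength_pos hY _).le)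
  exact le_mul_of_one_le_left (cellLength_pos hY _).le
    (by exact_mod_cast Nat.one_le_iff_ne_zero.2 hx)

theorem mixedTail_le_sub (hY : ∀ n, 2 ≤ Y n) {n m k : ℕ} (x : ∀ n, Fin (Y n)) (hnk : n ≤ k)
    (hkm : k < m) (hx : (x k).val ≠ Y k - 1) :
    mixedTail Y n x ≤ cellLength Y n - cellLength Y m := by
  obtain ⟨j, rfl⟩ := Nat.exists_eq_add_of_le' hnk
  have hs := (hasSum_max_digits hY n).sub (summable_digits hY n x).hasSum
  have h1 : cellLength Y (j + n + 1) ≤ cellLength Y n - mixedTail Y n x := by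
    refine le_trans ?_ (le_hasSum hs j fun i _ => sub_nonneg.2
      (mul_le_mul_of_nonneg_right (digit_le x _) (cellLength_pos hY _).le))
    rw [← sub_mul]
    refine le_mul_of_one_le_left (cellLength_pos hY _).le ?_
    have h2 : (x (j + n)).val + 2 ≤ Y (j + n) := by
      have := (x (j + n)).isLt
      omega
    have h3 : ((x (j + n)).val : ℝ) + 2 ≤ Y (j + n) := by exact_mod_cast h2
    linarith
  linarith [cellLength_antitone hY (Nat.succ_le_of_lt hkm)]

theorem prefixNat_congr {x y : ∀ n, Fin (Y n)} {n : ℕ} (h : ∀ k < n, y k = x k) :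
    prefixNat Y y n = prefixNat Y x n := by
  induction n with
  | zero => rfl
  | succ n ih =>
    rw [prefixNat, prefixNat, ih fun k hk => h k (hk.trans n.lt_succ_self), h n n.lt_succ_self]

theorem eq_of_prefixNat_eq {x y : ∀ n, Fin (Y n)} {n : ℕ}
    (h : prefixNat Y y n = prefixNat Y x n) : ∀ k < n, y k = x k := by
  induction n with
  | zero => intro k hk; omega
  | succ n ih =>
    rw [prefixNat, prefixNat] at h
    have hpos : 0 < Y n := (x n).pos
    have hmod := congrArg (· % Y n) h
    simp only [Nat.mul_add_mod_self_right, Nat.mod_eq_of_lt (x n).isLt,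
      Nat.mod_eq_of_lt (y n).isLt] at hmod
    have hpre : prefixNat Y y n = prefixNat Y x n := by
      rw [hmod] at h
      exact Nat.eq_of_mul_eq_mul_right hpos (Nat.add_right_cancel h)
    intro k hk
    rcases Nat.lt_succ_iff_lt_or_eq.1 hk with hk | rfl
    · exact ih hpre k hk
    · exact Fin.ext hmod

/-- Sequences in the cylinder of generation `n` of `x` expand to points at distance at most
`cellLength Y n` from the expansion of `x`. -/
theorem cylAt_subset_preimage (hY : ∀ n, 2 ≤ Y n) (x : ∀ n, Fin (Y n)) {n : ℕ} {r : ℝ}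
    (hr : cellLength Y n ≤ r) :
    cylAt n x ⊆ ofMixedDigits Y ⁻¹' closedBall (ofMixedDigits Y x) r := by
  intro y hy
  rw [mem_preimage, mem_closedBall, Real.dist_eq, ofMixedDigits_eq hY x n,
    ofMixedDigits_eq hY y n, prefixNat_congr hy]
  have := mixedTail_nonneg hY n x
  have := mixedTail_nonneg hY n y
  have := mixedTail_le hY n x
  have := mixedTail_le hY n y
  rw [abs_le]
  constructor <;> linarith

/-- If the digits of `x` of index in `[n, m)` are neither all minimal nor all maximal, then the
points within a distance less than `cellLength Y m` of the expansion of `x` share its first `n`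
digits. -/
theorem preimage_subset_cylAt (hY : ∀ n, 2 ≤ Y n) (x : ∀ n, Fin (Y n)) {n m : ℕ} {r : ℝ}
    (hmin : ∃ k, n ≤ k ∧ k < m ∧ (x k).val ≠ 0)
    (hmax : ∃ k, n ≤ k ∧ k < m ∧ (x k).val ≠ Y k - 1) (hr : r < cellLength Y m) :
    ofMixedDigits Y ⁻¹' closedBall (ofMixedDigits Y x) r ⊆ cylAt n x := by
  intro y hy
  rw [mem_preimage, mem_closedBall, Real.dist_eq, ofMixedDigits_eq hY x n,
    ofMixedDigits_eq hY y n, abs_le] at hy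
  obtain ⟨k, hnk, hkm, hk⟩ := hmin
  have h1 := le_mixedTail hY x hnk hkm hk
  obtain ⟨k, hnk, hkm, hk⟩ := hmax
  have h2 := mixedTail_le_sub hY x hnk hkm hk
  have h3 := mixedTail_nonneg hY n y
  have h4 := mixedTail_le hY n y
  have hD := cellLength_pos hY n
  refine eq_of_prefixNat_eq ?_
  have h5 : (prefixNat Y y n : ℝ) < prefixNat Y x n + 1 := by
    refine lt_of_mul_lt_mul_right ?_ hD.le
    linarith [hy.2]
  have h6 : (prefixNat Y x n : ℝ) < prefixNat Y y n + 1 := by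
    refine lt_of_mul_lt_mul_right ?_ hD.le
    linarith [hy.1]
  norm_cast at h5 h6
  omega

theorem continuous_ofMixedDigits (hY : ∀ n, 2 ≤ Y n) : Continuous (ofMixedDigits Y) := by
  refine continuous_tsum (u := fun k => ((Y k : ℝ) - 1) * cellLength Y (k + 1))
    (fun k => ?_) (hasSum_max_digits hY 0).summable fun k x => ?_
  · exact ((continuous_of_discreteTopology (f := fun i : Fin (Y k) => (i.val : ℝ))).comp
      (continuous_apply k)).mul continuous_const
  · rw [Real.norm_of_nonneg (mul_nonneg (Nat.cast_nonneg _) (cellLength_pos hY _).le)]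
    exact mul_le_mul_of_nonneg_right (digit_le x k) (cellLength_pos hY _).le

end MixedBase

/-! ### Multinomial measures with position-dependent weights -/

/-- The product of the weights of the first `n` terms of `x`. -/
def prodWeight {Y : ℕ → ℕ} (p : ℕ → ℕ → ℝ) (n : ℕ) (x : ∀ n, Fin (Y n)) : ℝ :=
  ∏ k ∈ Finset.range n, p k (x k).val

/-- The sequence obtained from `z` by replacing its first `n` terms by the word `w`. -/
def extendWord {Y : ℕ → ℕ} {n : ℕ} (z : ∀ n, Fin (Y n)) (w : ∀ i : Fin n, Fin (Y i.val)) :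
    ∀ n, Fin (Y n) :=
  fun k => if h : k < n then w ⟨k, h⟩ else z k

/-- The sequences that agree with `z` on the indices in `[m, n)`. -/
def agreeOn {Y : ℕ → ℕ} (m n : ℕ) (z : ∀ n, Fin (Y n)) : Set (∀ n, Fin (Y n)) :=
  {x | ∀ k, m ≤ k → k < n → x k = z k}

section Weights

variable {Y : ℕ → ℕ}

theorem sum_words_prod (f : ℕ → ℕ → ℝ) (n : ℕ) :
    ∑ w : (∀ i : Fin n, Fin (Y i.val)), ∏ i : Fin n, f i.val (w i).val =
      ∏ k ∈ Finset.range n, ∑ j ∈ Finset.range (Y k), f k j := by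
  rw [Finset.prod_range]
  simp only [Finset.sum_range]
  rw [Finset.prod_univ_sum, Fintype.piFinset_univ]

theorem prodWeight_extendWord (p : ℕ → ℕ → ℝ) {n : ℕ} (z : ∀ n, Fin (Y n))
    (w : ∀ i : Fin n, Fin (Y i.val)) :
    prodWeight p n (extendWord z w) = ∏ i : Fin n, p i.val (w i).val := by
  rw [prodWeight, Finset.prod_range]
  simp [extendWord]

theorem prodWeight_pos {p : ℕ → ℕ → ℝ} (hp : ∀ n, ∀ i < Y n, 0 < p n i) (n : ℕ)
    (x : ∀ n, Fin (Y n)) : 0 < prodWeight p n x :=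
  Finset.prod_pos fun k _ => hp k _ (x k).isLt

theorem prodWeight_add (p : ℕ → ℕ → ℝ) (m l : ℕ) (x : ∀ n, Fin (Y n)) :
    prodWeight p (m + l) x =
      prodWeight p m x * ∏ k ∈ Finset.range l, p (m + k) (x (m + k)).val :=
  Finset.prod_range_add _ _ _

theorem prodWeight_le_mul {p : ℕ → ℕ → ℝ} {δ : ℝ} (hδ : 0 < δ)
    (hp : ∀ n, ∀ i < Y n, δ ≤ p n i) (m l : ℕ) (x : ∀ n, Fin (Y n)) :
    prodWeight p m x ≤ δ⁻¹ ^ l * prodWeight p (m + l) x := by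
  rw [prodWeight_add]
  have h0 := prodWeight_pos (fun n i hi => hδ.trans_le (hp n i hi)) m x
  have h1 : δ ^ l ≤ ∏ k ∈ Finset.range l, p (m + k) (x (m + k)).val := by
    have h2 : ∏ _k ∈ Finset.range l, δ = δ ^ l := by simp
    rw [← h2]
    exact Finset.prod_le_prod (fun _ _ => hδ.le) fun k _ => hp _ _ (x _).isLt
  rw [inv_pow, inv_mul_eq_div, le_div_iff₀ (by positivity)]
  exact mul_le_mul_of_nonneg_left h1 h0.le

theorem measure_agreeOn_le {p : ℕ → ℕ → ℝ} {ρ : ℝ} (hp0 : ∀ n, ∀ i < Y n, 0 ≤ p n i)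
    (hpρ : ∀ n, ∀ i < Y n, p n i ≤ ρ) (hsum : ∀ n, ∑ i ∈ Finset.range (Y n), p n i = 1)
    (μ : Measure (∀ n, Fin (Y n)))
    (hμ : ∀ n x, μ (cylAt n x) = ENNReal.ofReal (prodWeight p n x))
    (m l : ℕ) (z : ∀ n, Fin (Y n)) :
    μ (agreeOn m (m + l) z) ≤ ENNReal.ofReal (ρ ^ l) := by
  have hρ : 0 ≤ ρ := (hp0 0 _ (z 0).isLt).trans (hpρ 0 _ (z 0).isLt)
  have hsub : agreeOn m (m + l) z ⊆
      ⋃ w : (∀ i : Fin m, Fin (Y i.val)), cylAt (m + l) (extendWord z w) := by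
    intro x hx
    refine mem_iUnion.2 ⟨fun i => x i.val, fun k hk => ?_⟩
    by_cases h : k < m
    · simp [extendWord, h]
    · simp [extendWord, h, hx k (not_lt.1 h) hk]
  have hw : ∀ w : (∀ i : Fin m, Fin (Y i.val)), prodWeight p (m + l) (extendWord z w) ≤
      (∏ i : Fin m, p i.val (w i).val) * ρ ^ l := by
    intro w
    rw [prodWeight_add, prodWeight_extendWord]
    refine mul_le_mul_of_nonneg_left ?_ (Finset.prod_nonneg fun i _ => hp0 _ _ (w i).isLt)
    have h2 : ∏ _k ∈ Finset.range l, ρ = ρ ^ l := by simp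
    rw [← h2]
    exact Finset.prod_le_prod (fun _ _ => hp0 _ _ (Fin.isLt _)) fun k _ => hpρ _ _ (Fin.isLt _)
  calc μ (agreeOn m (m + l) z)
      ≤ ∑ w : (∀ i : Fin m, Fin (Y i.val)), μ (cylAt (m + l) (extendWord z w)) :=
        (measure_mono hsub).trans (measure_iUnion_fintype_le _ _)
    _ ≤ ∑ w : (∀ i : Fin m, Fin (Y i.val)),
          ENNReal.ofReal ((∏ i : Fin m, p i.val (w i).val) * ρ ^ l) :=
        Finset.sum_le_sum fun w _ => (hμ _ _).trans_le (ENNReal.ofReal_le_ofReal (hw w))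
    _ = ENNReal.ofReal (ρ ^ l) := by
        rw [← ENNReal.ofReal_sum_of_nonneg fun w _ => mul_nonneg
          (Finset.prod_nonneg fun i _ => hp0 _ _ (w i).isLt) (pow_nonneg hρ l),
          ← Finset.sum_mul, sum_words_prod]
        simp [hsum]

theorem summable_pow_div {ρ : ℝ} (hρ0 : 0 < ρ) (hρ1 : ρ < 1) {K : ℕ} (hK : 0 < K) :
    Summable fun n : ℕ => ρ ^ (n / K) := by
  have hK' : (0 : ℝ) < K := by exact_mod_cast hK
  have hs : ρ ^ (1 / K : ℝ) < 1 := Real.rpow_lt_one hρ0.le hρ1 (by positivity)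
  refine Summable.of_nonneg_of_le (fun n => by positivity) (fun n => ?_)
    ((summable_geometric_of_lt_one (by positivity) hs).mul_right ρ⁻¹)
  rw [← Real.rpow_natCast, ← Real.rpow_natCast, ← Real.rpow_mul hρ0.le, ← Real.rpow_neg_one ρ,
    ← Real.rpow_add hρ0]
  refine Real.rpow_le_rpow_of_exponent_ge hρ0 hρ1.le ?_
  have h1 : n < K * (n / K + 1) := Nat.lt_mul_div_succ n hK
  have h2 : (n : ℝ) ≤ K * ((n / K : ℕ) + 1) := by exact_mod_cast h1.le
  have h3 : (n : ℝ) / K ≤ (n / K : ℕ) + 1 := by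
    rw [div_le_iff₀ hK']
    linarith
  have h4 : (1 / K : ℝ) * n = n / K := by ring
  linarith

theorem ae_eventually_notMem_agreeOn {p : ℕ → ℕ → ℝ} {ρ : ℝ} (hρ0 : 0 < ρ) (hρ1 : ρ < 1)
    (hp0 : ∀ n, ∀ i < Y n, 0 ≤ p n i)
    (hpρ : ∀ n, ∀ i < Y n, p n i ≤ ρ) (hsum : ∀ n, ∑ i ∈ Finset.range (Y n), p n i = 1)
    (μ : Measure (∀ n, Fin (Y n)))
    (hμ : ∀ n x, μ (cylAt n x) = ENNReal.ofReal (prodWeight p n x))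
    {K : ℕ} (hK : 0 < K) (z : ∀ n, Fin (Y n)) :
    ∀ᵐ x ∂μ, ∀ᶠ n in atTop, x ∉ agreeOn (n - n / K) n z := by
  refine ae_eventually_notMem (ne_top_of_le_ne_top (summable_pow_div hρ0 hρ1 hK).tsum_ofReal_ne_top
    (ENNReal.tsum_le_tsum fun n => ?_))
  have h := measure_agreeOn_le hp0 hpρ hsum μ hμ (n - n / K) (n / K) z
  rwa [Nat.sub_add_cancel (Nat.div_le_self n K)] at h

theorem isOpen_agreeOn (m n : ℕ) (z : ∀ n, Fin (Y n)) : IsOpen (agreeOn m n z) := by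
  have : agreeOn m n z = ⋂ k ∈ Finset.Ico m n, (fun x => x k) ⁻¹' {z k} := by
    ext x
    simp [agreeOn]
  rw [this]
  exact isOpen_biInter_finset fun k _ =>
    (isOpen_discrete {z k}).preimage (continuous_apply k)

theorem rpow_le_mul_rpow_of_le {u v κ : ℝ} (hv : 0 < v) (hvu : v ≤ u) (huκ : u ≤ κ * v)
    (s : ℝ) : u ^ s ≤ κ ^ |s| * v ^ s := by
  have hκ : 1 ≤ κ := by
    by_contra! h
    nlinarith
  rcases le_or_gt 0 s with hs | hs
  · rw [abs_of_nonneg hs, ← Real.mul_rpow (by linarith) hv.le]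
    exact Real.rpow_le_rpow (hv.le.trans hvu) huκ hs
  · exact (Real.rpow_le_rpow_of_nonpos hv hvu hs.le).trans
      (le_mul_of_one_le_left (Real.rpow_nonneg hv.le _)
        (Real.one_le_rpow hκ (abs_nonneg s)))

theorem exists_pow_div_le {A ε : ℝ} (hA : 1 ≤ A) (hε : 0 < ε) :
    ∃ K : ℕ, 2 ≤ K ∧ ∀ n ≥ K, A ^ (n / K + 1) ≤ (2 : ℝ) ^ (n * ε) := by
  obtain ⟨K₀, hK₀⟩ := exists_nat_ge (2 * Real.log A / (ε * Real.log 2))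
  refine ⟨max K₀ 2, le_max_right _ _, fun n hn => ?_⟩
  set K := max K₀ 2
  have hl2 : 0 < Real.log 2 := Real.log_pos one_lt_two
  have hK2 : (2 : ℝ) ≤ K := by exact_mod_cast le_max_right K₀ 2
  have hlK : 2 * Real.log A ≤ K * (ε * Real.log 2) := by
    rw [← div_le_iff₀ (by positivity)]
    exact hK₀.trans (by exact_mod_cast le_max_left K₀ 2)
  have hlA := Real.log_nonneg hA
  have h1 : ((n / K : ℕ) + 1 : ℝ) * K ≤ 2 * n := by
    have h2 : (n / K) * K ≤ n := Nat.div_mul_le_self n K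
    have h3 : (n / K + 1) * K ≤ 2 * n := by rw [add_mul]; omega
    exact_mod_cast h3
  rw [← Real.rpow_natCast, Real.rpow_def_of_pos (by linarith), Real.rpow_def_of_pos two_pos,
    Real.exp_le_exp]
  push_cast
  refine le_of_mul_le_mul_right ?_ (lt_of_lt_of_le two_pos hK2)
  calc Real.log A * ((n / K : ℕ) + 1) * K
      = Real.log A * (((n / K : ℕ) + 1) * K) := by ring
    _ ≤ Real.log A * (2 * n) := mul_le_mul_of_nonneg_left h1 hlA
    _ = 2 * Real.log A * n := by ring
    _ ≤ K * (ε * Real.log 2) * n := by gcongr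
    _ = Real.log 2 * (n * ε) * K := by ring

theorem exists_cellLength_le_lt (hY : ∀ n, 2 ≤ Y n) {N : ℕ} {r : ℝ} (hr : 0 < r)
    (hrN : r < cellLength Y N) : ∃ n ≥ N, cellLength Y (n + 1) ≤ r ∧ r < cellLength Y n := by
  have hex : ∃ n, cellLength Y n ≤ r :=
    ((tendsto_cellLength hY).eventually_le_const hr).exists
  have hN : N < Nat.find hex := by
    by_contra! h
    exact absurd (Nat.find_spec hex) (not_le.2 (hrN.trans_le (cellLength_antitone hY h)))
  refine ⟨Nat.find hex - 1, by omega, ?_, ?_⟩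
  · rw [Nat.sub_add_cancel (by omega)]
    exact Nat.find_spec hex
  · exact not_le.1 (Nat.find_min hex (by omega))

/-- The mass of a ball is controlled as soon as the digits of its center with index in
`[m, m + l)` are neither all minimal nor all maximal. -/
theorem map_closedBall_le (hY : ∀ n, 2 ≤ Y n) {M : ℝ} (hM : ∀ n, (Y n : ℝ) ≤ M)
    {p pq : ℕ → ℕ → ℝ} {δ : ℝ} (hδ : 0 < δ) (hp : ∀ n, ∀ i < Y n, δ ≤ p n i)
    (μ μq : Measure (∀ n, Fin (Y n))) [IsProbabilityMeasure μ]
    (hμ : ∀ n x, μ (cylAt n x) = ENNReal.ofReal (prodWeight p n x))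
    (hμq : ∀ n x, μq (cylAt n x) = ENNReal.ofReal (prodWeight pq n x))
    {q s ε : ℝ} (hε : 0 < ε) {m l : ℕ}
    (hpq : ∀ x : (∀ n, Fin (Y n)),
      prodWeight pq m x ≤ prodWeight p m x ^ q * cellLength Y m ^ s)
    (hl : (δ⁻¹ ^ |q| * M ^ |s|) ^ (l + 1) ≤ (2 : ℝ) ^ ((m + l : ℕ) * ε))
    (x : ∀ n, Fin (Y n))
    (hmin : ∃ k, m ≤ k ∧ k < m + l ∧ (x k).val ≠ 0)
    (hmax : ∃ k, m ≤ k ∧ k < m + l ∧ (x k).val ≠ Y k - 1) {r : ℝ} (hr : 0 < r)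
    (hr1 : cellLength Y (m + l + 1) ≤ r) (hr2 : r < cellLength Y (m + l)) :
    μq.map (ofMixedDigits Y) (closedBall (ofMixedDigits Y x) r) ≤
      μ.map (ofMixedDigits Y) (closedBall (ofMixedDigits Y x) r) ^ q *
        ENNReal.ofReal r ^ (s - ε) := by
  have hmeas := (continuous_ofMixedDigits hY).measurable
  rw [Measure.map_apply hmeas measurableSet_closedBall,
    Measure.map_apply hmeas measurableSet_closedBall]
  set B := ofMixedDigits Y ⁻¹' closedBall (ofMixedDigits Y x) r
  have hB : B ⊆ cylAt m x := preimage_subset_cylAt hY x hmin hmax hr2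
  have hB' : cylAt (m + (l + 1)) x ⊆ B := cylAt_subset_preimage hY x hr1
  have hM0 : 0 ≤ M := (Nat.cast_nonneg _).trans (hM 0)
  have hp' : ∀ n, ∀ i < Y n, 0 < p n i := fun n i hi => hδ.trans_le (hp n i hi)
  obtain ⟨V, hV⟩ : ∃ V : ℝ, μ.real B = V := ⟨_, rfl⟩
  have hW := prodWeight_pos hp' m x
  have hVW : V ≤ prodWeight p m x := by
    have h := measureReal_mono (μ := μ) hB
    rwa [hV, measureReal_def, hμ, ENNReal.toReal_ofReal hW.le] at h
  have hW' := prodWeight_pos hp' (m + (l + 1)) x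
  have hVW' : prodWeight p (m + (l + 1)) x ≤ V := by
    have h := measureReal_mono (μ := μ) hB'
    rwa [hV, measureReal_def, hμ, ENNReal.toReal_ofReal hW'.le] at h
  have hV0 : 0 < V := hW'.trans_le hVW'
  have hWq : prodWeight p m x ^ q ≤ (δ⁻¹ ^ (l + 1)) ^ |q| * V ^ q := by
    refine rpow_le_mul_rpow_of_le hV0 hVW ((prodWeight_le_mul hδ hp m (l + 1) x).trans ?_) q
    gcongr
  have hDs : cellLength Y m ^ s ≤ (M ^ (l + 1)) ^ |s| * r ^ s := by
    refine rpow_le_mul_rpow_of_le hr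
      (hr2.le.trans (cellLength_antitone hY (Nat.le_add_right m l)))
      ((cellLength_le_pow_mul hY hM m (l + 1)).trans ?_) s
    gcongr
    exact hr1
  have hrε : (2 : ℝ) ^ ((m + l : ℕ) * ε) ≤ r ^ (-ε) := by
    have h := Real.rpow_le_rpow_of_nonpos hr (hr2.le.trans (cellLength_le_half_pow hY _))
      (neg_nonpos.2 hε.le)
    refine le_of_eq_of_le ?_ h
    rw [← Real.rpow_natCast, ← Real.rpow_mul (by norm_num), one_div, Real.inv_rpow two_pos.le,
      ← Real.rpow_neg two_pos.le]
    ring_nf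
  have hreal : prodWeight pq m x ≤ V ^ q * r ^ (s - ε) := by
    calc prodWeight pq m x ≤ prodWeight p m x ^ q * cellLength Y m ^ s := hpq x
      _ ≤ ((δ⁻¹ ^ (l + 1)) ^ |q| * V ^ q) * ((M ^ (l + 1)) ^ |s| * r ^ s) :=
          mul_le_mul hWq hDs (Real.rpow_nonneg (cellLength_pos hY m).le s)
            (mul_nonneg (by positivity) (Real.rpow_nonneg hV0.le q))
      _ = (δ⁻¹ ^ |q| * M ^ |s|) ^ (l + 1) * (V ^ q * r ^ s) := by
          rw [mul_pow, ← Real.rpow_mul_natCast (inv_pos.2 hδ).le, ← Real.rpow_mul_natCast hM0,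
            ← Real.rpow_natCast_mul (inv_pos.2 hδ).le, ← Real.rpow_natCast_mul hM0,
            mul_comm |q|, mul_comm |s|]
          ring
      _ ≤ r ^ (-ε) * (V ^ q * r ^ s) := by
          gcongr
          exact hl.trans hrε
      _ = V ^ q * r ^ (s - ε) := by
          rw [sub_eq_add_neg, Real.rpow_add hr]
          ring
  have hμB : μ B = ENNReal.ofReal V := by rw [← hV, ofReal_measureReal]
  rw [hμB, ENNReal.ofReal_rpow_of_pos hV0, ENNReal.ofReal_rpow_of_pos hr,
    ← ENNReal.ofReal_mul (by positivity)]
  exact (measure_mono hB).trans ((hμq m x).trans_le (ENNReal.ofReal_le_ofReal hreal))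

theorem ae_map_closedBall_le (hY : ∀ n, 2 ≤ Y n) {M : ℝ} (hM : ∀ n, (Y n : ℝ) ≤ M)
    {p pq : ℕ → ℕ → ℝ} {δ ρ : ℝ} (hδ : 0 < δ) (hδ1 : δ ≤ 1)
    (hp : ∀ n, ∀ i < Y n, δ ≤ p n i) (hρ0 : 0 < ρ) (hρ1 : ρ < 1)
    (hpq0 : ∀ n, ∀ i < Y n, 0 ≤ pq n i) (hpqρ : ∀ n, ∀ i < Y n, pq n i ≤ ρ)
    (hsum : ∀ n, ∑ i ∈ Finset.range (Y n), pq n i = 1)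
    (μ μq : Measure (∀ n, Fin (Y n))) [IsProbabilityMeasure μ]
    (hμ : ∀ n x, μ (cylAt n x) = ENNReal.ofReal (prodWeight p n x))
    (hμq : ∀ n x, μq (cylAt n x) = ENNReal.ofReal (prodWeight pq n x))
    {q s ε : ℝ} (hε : 0 < ε)
    (hpq : ∀ᶠ m in atTop, ∀ x : (∀ n, Fin (Y n)),
      prodWeight pq m x ≤ prodWeight p m x ^ q * cellLength Y m ^ s) :
    ∀ᵐ x ∂(μq.map (ofMixedDigits Y)),
      ∃ rx : ℝ, 0 < rx ∧ ∀ r : ℝ, 0 < r → r < rx →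
        μq.map (ofMixedDigits Y) (closedBall x r) ≤
          μ.map (ofMixedDigits Y) (closedBall x r) ^ q * ENNReal.ofReal r ^ (s - ε) := by
  have hM1 : 1 ≤ M := le_trans (by exact_mod_cast one_le_two.trans (hY 0)) (hM 0)
  obtain ⟨K, hK2, hK⟩ := exists_pow_div_le (A := δ⁻¹ ^ |q| * M ^ |s|)
    (one_le_mul_of_one_le_of_one_le
      (Real.one_le_rpow ((one_le_inv₀ hδ).2 hδ1) (abs_nonneg q))
      (Real.one_le_rpow hM1 (abs_nonneg s))) hε
  obtain ⟨m₀, hm₀⟩ := eventually_atTop.1 hpq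
  have hcont := continuous_ofMixedDigits hY
  let zmin : ∀ n, Fin (Y n) := fun n => ⟨0, two_pos.trans_le (hY n)⟩
  let zmax : ∀ n, Fin (Y n) := fun n => ⟨Y n - 1, Nat.sub_lt (two_pos.trans_le (hY n)) one_pos⟩
  let bad : ℕ → Set (∀ n, Fin (Y n)) := fun n =>
    agreeOn (n - n / K) n zmin ∪ agreeOn (n - n / K) n zmax
  let good : ℕ → Set (∀ n, Fin (Y n)) := fun N => ⋂ n, ⋂ (_ : N ≤ n), (bad n)ᶜ
  have hgood : ∀ N, IsCompact (good N) := fun N =>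
    (isClosed_iInter fun n => isClosed_iInter fun _ =>
      ((isOpen_agreeOn _ _ _).union (isOpen_agreeOn _ _ _)).isClosed_compl).isCompact
  have hE : MeasurableSet (⋃ N, ofMixedDigits Y '' good N) :=
    MeasurableSet.iUnion fun N => ((hgood N).image hcont).measurableSet
  have hae : ∀ᵐ x ∂(μq.map (ofMixedDigits Y)), x ∈ ⋃ N, ofMixedDigits Y '' good N := by
    refine (ae_map_iff hcont.aemeasurable hE).2 ?_
    filter_upwards
      [ae_eventually_notMem_agreeOn hρ0 hρ1 hpq0 hpqρ hsum μq hμq (by omega : 0 < K) zmin,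
      ae_eventually_notMem_agreeOn hρ0 hρ1 hpq0 hpqρ hsum μq hμq (by omega : 0 < K) zmax]
      with x hx1 hx2
    obtain ⟨N, hN⟩ := eventually_atTop.1 (hx1.and hx2)
    refine mem_iUnion.2 ⟨N, x, mem_iInter₂.2 fun n hn => ?_, rfl⟩
    exact fun h => h.elim (hN n hn).1 (hN n hn).2
  filter_upwards [hae] with y hy
  obtain ⟨N, x, hx, rfl⟩ := mem_iUnion.1 hy
  refine ⟨cellLength Y (max N (max K (2 * m₀))), cellLength_pos hY _, fun r hr hrx => ?_⟩
  obtain ⟨n, hn, hr1, hr2⟩ := exists_cellLength_le_lt hY hr hrx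
  have hnN : N ≤ n := (le_max_left _ _).trans hn
  have hnK : K ≤ n := (le_max_left _ _).trans ((le_max_right _ _).trans hn)
  have hnm : 2 * m₀ ≤ n := (le_max_right _ _).trans ((le_max_right _ _).trans hn)
  have hdiv : n / K ≤ n / 2 := Nat.div_le_div_left hK2 two_pos
  have hnl : n - n / K + n / K = n := Nat.sub_add_cancel (Nat.div_le_self n K)
  have hxn : x ∉ bad n := mem_iInter₂.1 hx n hnN
  simp only [bad, mem_union, not_or, agreeOn, mem_ofPred_eq, not_forall] at hxn
  obtain ⟨⟨k, hk1, hk2, hk⟩, ⟨j, hj1, hj2, hj⟩⟩ := hxn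
  refine map_closedBall_le hY hM hδ hp μ μq hμ hμq hε (m := n - n / K) (l := n / K)
    (hm₀ _ (by omega)) ?_ x ⟨k, hk1, by omega, fun h => hk (Fin.ext h)⟩
    ⟨j, hj1, by omega, fun h => hj (Fin.ext h)⟩ hr ?_ ?_
  · rw [hnl]
    exact hK n hnK
  · rwa [hnl]
  · rwa [hnl]

end Weights

/-! ### The mixed symbolic space as a mixed base -/

/-- The weights of the letters at position `n`. -/
def mixedWeight (T : ℕ → ℕ) (a b : ℕ → ℝ) (n i : ℕ) : ℝ := if isA T (n + 1) then a i else b i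

theorem Ncount_le (T : ℕ → ℕ) (n : ℕ) : Ncount T n ≤ n :=
  (Finset.card_filter_le _ _).trans (by simp)

theorem Ncount_succ (T : ℕ → ℕ) (n : ℕ) :
    Ncount T (n + 1) = Ncount T n + if isA T (n + 1) then 1 else 0 := by
  have h : Finset.Icc 1 (n + 1) = insert (n + 1) (Finset.Icc 1 n) := by
    ext j
    simp only [Finset.mem_Icc, Finset.mem_insert]
    omega
  rw [Ncount, Ncount, h, Finset.filter_insert]
  split_ifs <;> simp

theorem Dw_eq_cellLength (c₁ c₂ : ℕ) (T : ℕ → ℕ) (n : ℕ) :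
    Dw c₁ c₂ T n = cellLength (Yc c₁ c₂ T) n := by
  induction n with
  | zero => simp [Dw, Ncount, cellLength]
  | succ n ih =>
    have h := Ncount_le T n
    rw [cellLength_succ, ← ih, Dw, Dw, Ncount_succ, Yc, ← mul_inv]
    congr 1
    split_ifs
    · rw [Nat.add_sub_add_right]
      ring
    · rw [add_zero, Nat.sub_add_comm h]
      ring

theorem gammaMap_eq_ofMixedDigits (c₁ c₂ : ℕ) (T : ℕ → ℕ) :
    gammaMap c₁ c₂ T = ofMixedDigits (Yc c₁ c₂ T) := by
  funext x
  simp only [gammaMap, ofMixedDigits, Dw_eq_cellLength]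

theorem measure_cylAt_of_cyl {c₁ c₂ : ℕ} {T : ℕ → ℕ} {a b : ℕ → ℝ} (μ : Measure (Omg c₁ c₂ T))
    (hμ : ∀ (n : ℕ) (w : Word c₁ c₂ T n),
      μ (cyl c₁ c₂ T n w) = ENNReal.ofReal (cylWeight c₁ c₂ T a b n w))
    (n : ℕ) (x : Omg c₁ c₂ T) :
    μ (cylAt n x) = ENNReal.ofReal (prodWeight (mixedWeight T a b) n x) := by
  have h1 : cylAt n x = cyl c₁ c₂ T n fun i => x i.val := by
    ext y
    exact ⟨fun h i => h i i.isLt, fun h k hk => h ⟨k, hk⟩⟩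
  rw [h1, hμ, prodWeight, Finset.prod_range]
  rfl

theorem mixedWeight_forall {c₁ c₂ : ℕ} {T : ℕ → ℕ} {a b : ℕ → ℝ} {P : ℝ → Prop}
    (ha : ∀ i < c₁, P (a i)) (hb : ∀ i < c₂, P (b i)) :
    ∀ n, ∀ i < Yc c₁ c₂ T n, P (mixedWeight T a b n i) := by
  intro n i hi
  rw [Yc] at hi
  rw [mixedWeight]
  split_ifs at hi ⊢
  · exact ha i hi
  · exact hb i hi

/-- The partition function of order `q` of the weights at position `n`. -/
def mixedPartition (c₁ c₂ : ℕ) (T : ℕ → ℕ) (a b : ℕ → ℝ) (q : ℝ) (n : ℕ) : ℝ :=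
  if isA T (n + 1) then ∑ i ∈ Finset.range c₁, a i ^ q else ∑ i ∈ Finset.range c₂, b i ^ q

theorem mixedWeight_taW (c₁ c₂ : ℕ) (T : ℕ → ℕ) (a b : ℕ → ℝ) (q : ℝ) (n i : ℕ) :
    mixedWeight T (taW c₁ a q) (taW c₂ b q) n i =
      mixedWeight T a b n i ^ q / mixedPartition c₁ c₂ T a b q n := by
  rw [mixedWeight, mixedWeight, mixedPartition]
  split_ifs <;> rfl

theorem sum_cylWeight_rpow {c₁ c₂ : ℕ} {T : ℕ → ℕ} {a b : ℕ → ℝ} (ha : ∀ i < c₁, 0 < a i)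
    (hb : ∀ i < c₂, 0 < b i) (q : ℝ) (n : ℕ) :
    ∑ z : Word c₁ c₂ T n, cylWeight c₁ c₂ T a b n z ^ q =
      ∏ k ∈ Finset.range n, mixedPartition c₁ c₂ T a b q k := by
  have h1 : ∀ z : Word c₁ c₂ T n, cylWeight c₁ c₂ T a b n z ^ q =
      ∏ i : Fin n, mixedWeight T a b i.val (z i).val ^ q := fun z =>
    (Real.finsetProd_rpow _ _
      (fun i _ => (mixedWeight_forall (P := (0 < ·)) ha hb i.val _ (z i).isLt).le) q).symm
  simp only [h1]
  rw [sum_words_prod fun k j => mixedWeight T a b k j ^ q]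
  refine Finset.prod_congr rfl fun k _ => ?_
  simp only [mixedWeight, mixedPartition, Yc]
  split_ifs <;> rfl

theorem prodWeight_taW {c₁ c₂ : ℕ} {T : ℕ → ℕ} {a b : ℕ → ℝ} (ha : ∀ i < c₁, 0 < a i)
    (hb : ∀ i < c₂, 0 < b i) (q : ℝ) (n : ℕ) (x : Omg c₁ c₂ T) :
    prodWeight (mixedWeight T (taW c₁ a q) (taW c₂ b q)) n x =
      prodWeight (mixedWeight T a b) n x ^ q /
        ∏ k ∈ Finset.range n, mixedPartition c₁ c₂ T a b q k := by
  simp only [prodWeight, mixedWeight_taW c₁ c₂]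
  rw [Finset.prod_div_distrib, Real.finsetProd_rpow _ _
    fun k _ => (mixedWeight_forall (P := (0 < ·)) ha hb k _ (x k).isLt).le]

theorem sum_rpow_pos {c : ℕ} (hc : 2 ≤ c) {a : ℕ → ℝ} (ha : ∀ i < c, 0 < a i) (q : ℝ) :
    0 < ∑ i ∈ Finset.range c, a i ^ q :=
  Finset.sum_pos (fun i hi => Real.rpow_pos_of_pos (ha i (Finset.mem_range.1 hi)) q)
    ⟨0, Finset.mem_range.2 (by omega)⟩

theorem taW_pos {c : ℕ} (hc : 2 ≤ c) {a : ℕ → ℝ} (ha : ∀ i < c, 0 < a i) (q : ℝ) :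
    ∀ i < c, 0 < taW c a q i := fun i hi =>
  div_pos (Real.rpow_pos_of_pos (ha i hi) q) (sum_rpow_pos hc ha q)

theorem taW_lt_one {c : ℕ} (hc : 2 ≤ c) {a : ℕ → ℝ} (ha : ∀ i < c, 0 < a i) (q : ℝ) :
    ∀ i < c, taW c a q i < 1 := by
  intro i hi
  rw [taW, div_lt_one (sum_rpow_pos hc ha q)]
  obtain ⟨j, hj, hji⟩ : ∃ j < c, j ≠ i := by
    by_cases h : i = 0
    · exact ⟨1, by omega, by omega⟩
    · exact ⟨0, by omega, by omega⟩
  exact Finset.single_lt_sum hji (Finset.mem_range.2 hi) (Finset.mem_range.2 hj)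
    (Real.rpow_pos_of_pos (ha j hj) q)
    fun k hk _ => (Real.rpow_pos_of_pos (ha k (Finset.mem_range.1 hk)) q).le

theorem sum_taW {c : ℕ} (hc : 2 ≤ c) {a : ℕ → ℝ} (ha : ∀ i < c, 0 < a i) (q : ℝ) :
    ∑ i ∈ Finset.range c, taW c a q i = 1 := by
  simp only [taW]
  rw [← Finset.sum_div, div_self (sum_rpow_pos hc ha q).ne']

theorem two_le_Yc {c₁ c₂ : ℕ} (hc₁ : 2 ≤ c₁) (hc₂ : 2 ≤ c₂) (T : ℕ → ℕ) (n : ℕ) :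
    2 ≤ Yc c₁ c₂ T n := by
  rw [Yc]
  split_ifs <;> assumption

theorem mixedPartition_pos {c₁ c₂ : ℕ} (hc₁ : 2 ≤ c₁) (hc₂ : 2 ≤ c₂) (T : ℕ → ℕ)
    {a b : ℕ → ℝ} (ha : ∀ i < c₁, 0 < a i) (hb : ∀ i < c₂, 0 < b i) (q : ℝ) (n : ℕ) :
    0 < mixedPartition c₁ c₂ T a b q n := by
  rw [mixedPartition]
  split_ifs
  · exact sum_rpow_pos hc₁ ha q
  · exact sum_rpow_pos hc₂ hb q

theorem tauN_eq {c₁ c₂ : ℕ} {T : ℕ → ℕ} {a b : ℕ → ℝ} (ha : ∀ i < c₁, 0 < a i)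
    (hb : ∀ i < c₂, 0 < b i) (q : ℝ) (n : ℕ) :
    tauN c₁ c₂ T a b q n =
      Real.log (∏ k ∈ Finset.range n, mixedPartition c₁ c₂ T a b q k) /
        -Real.log (cellLength (Yc c₁ c₂ T) n) := by
  rw [tauN, sum_cylWeight_rpow ha hb, ← Dw_eq_cellLength, Dw, Real.log_inv, neg_neg]

theorem log_two_mul_le_neg_log_cellLength {Y : ℕ → ℕ} (hY : ∀ n, 2 ≤ Y n) (n : ℕ) :
    n * Real.log 2 ≤ -Real.log (cellLength Y n) := by
  have h := Real.log_le_log (cellLength_pos hY n) (cellLength_le_half_pow hY n)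
  rw [Real.log_pow, one_div, Real.log_inv] at h
  linarith

theorem isBoundedUnder_ge_tauN {c₁ c₂ : ℕ} (hc₁ : 2 ≤ c₁) (hc₂ : 2 ≤ c₂) (T : ℕ → ℕ)
    {a b : ℕ → ℝ} (ha : ∀ i < c₁, 0 < a i) (hb : ∀ i < c₂, 0 < b i) (q : ℝ) :
    IsBoundedUnder (· ≥ ·) atTop (tauN c₁ c₂ T a b q) := by
  obtain ⟨B, hB0, hB⟩ : ∃ B : ℝ, 0 ≤ B ∧
      ∀ k, -B ≤ Real.log (mixedPartition c₁ c₂ T a b q k) := by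
    refine ⟨max |Real.log (∑ i ∈ Finset.range c₁, a i ^ q)|
      |Real.log (∑ i ∈ Finset.range c₂, b i ^ q)|, le_max_of_le_left (abs_nonneg _), fun k => ?_⟩
    rw [mixedPartition, neg_le]
    split_ifs
    · exact le_max_of_le_left (neg_le_abs _)
    · exact le_max_of_le_right (neg_le_abs _)
  have hl2 : 0 < Real.log 2 := Real.log_pos one_lt_two
  refine isBoundedUnder_of ⟨-(B / Real.log 2), fun n => ?_⟩
  have hX := log_two_mul_le_neg_log_cellLength (two_le_Yc hc₁ hc₂ T) n
  rw [ge_iff_le, tauN_eq ha hb,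
    Real.log_prod fun k _ => (mixedPartition_pos hc₁ hc₂ T ha hb q k).ne']
  have hS : -(n * B) ≤ ∑ k ∈ Finset.range n, Real.log (mixedPartition c₁ c₂ T a b q k) := by
    have h := Finset.card_nsmul_le_sum (Finset.range n) _ _ fun k _ => hB k
    simpa using h
  rcases (show 0 ≤ -Real.log (cellLength (Yc c₁ c₂ T) n) from
    le_trans (by positivity) hX).eq_or_lt with h0 | h0
  · rw [← h0, div_zero]
    exact neg_nonpos.2 (by positivity)
  · rw [le_div_iff₀ h0]
    refine le_trans ?_ hS
    rw [neg_mul, neg_le_neg_iff]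
    calc n * B = B / Real.log 2 * (n * Real.log 2) := by field_simp
      _ ≤ _ := by gcongr

theorem eventually_inv_partition_le {c₁ c₂ : ℕ} (hc₁ : 2 ≤ c₁) (hc₂ : 2 ≤ c₂) (T : ℕ → ℕ)
    {a b : ℕ → ℝ} (ha : ∀ i < c₁, 0 < a i) (hb : ∀ i < c₂, 0 < b i) (q : ℝ) {t : ℝ}
    (ht : t < liminf (tauN c₁ c₂ T a b q) atTop) :
    ∀ᶠ n in atTop, (∏ k ∈ Finset.range n, mixedPartition c₁ c₂ T a b q k)⁻¹ ≤
      cellLength (Yc c₁ c₂ T) n ^ t := by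
  have hY := two_le_Yc hc₁ hc₂ T
  filter_upwards [eventually_lt_of_lt_liminf ht (isBoundedUnder_ge_tauN hc₁ hc₂ T ha hb q),
    eventually_gt_atTop 0] with n hn hn0
  have hS : 0 < ∏ k ∈ Finset.range n, mixedPartition c₁ c₂ T a b q k :=
    Finset.prod_pos fun k _ => mixedPartition_pos hc₁ hc₂ T ha hb q k
  have hX : 0 < -Real.log (cellLength (Yc c₁ c₂ T) n) :=
    lt_of_lt_of_le (mul_pos (by exact_mod_cast hn0) (Real.log_pos one_lt_two))
      (log_two_mul_le_neg_log_cellLength hY n)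
  rw [tauN_eq ha hb, lt_div_iff₀ hX] at hn
  rw [Real.rpow_def_of_pos (cellLength_pos hY n), ← Real.log_le_iff_le_exp (inv_pos.2 hS),
    Real.log_inv]
  linarith

theorem exists_pos_forall_le {c : ℕ} (hc : 2 ≤ c) {a : ℕ → ℝ} (ha : ∀ i < c, 0 < a i) :
    ∃ δ, 0 < δ ∧ ∀ i < c, δ ≤ a i := by
  obtain ⟨i, hi, h⟩ := (Finset.range c).exists_min_image a ⟨0, Finset.mem_range.2 (by omega)⟩
  exact ⟨a i, ha i (Finset.mem_range.1 hi), fun j hj => h j (Finset.mem_range.2 hj)⟩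

/-- first assertion of Lemma 4.3. -/
theorem stmt8 (c₁ c₂ : ℕ) (hc₁ : 2 ≤ c₁) (hc₂ : 2 ≤ c₂)
    (T : ℕ → ℕ) (hT1 : T 1 = 1) (hTmono : ∀ k, 1 ≤ k → T k < T (k + 1))
    (hTrat : Tendsto (fun k => (T (k + 1) : ℝ) / (T k : ℝ)) atTop atTop)
    (a b : ℕ → ℝ) (ha : ∀ i, i < c₁ → 0 < a i ∧ a i < 1)
    (hb : ∀ j, j < c₂ → 0 < b j ∧ b j < 1)
    (hsa : ∑ i ∈ Finset.range c₁, a i = 1) (hsb : ∑ j ∈ Finset.range c₂, b j = 1)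
    (q : ℝ)
    (μ μq : Measure (Omg c₁ c₂ T)) [IsProbabilityMeasure μ] [IsProbabilityMeasure μq]
    (hμ : ∀ (n : ℕ) (w : Word c₁ c₂ T n),
      μ (cyl c₁ c₂ T n w) = ENNReal.ofReal (cylWeight c₁ c₂ T a b n w))
    (hμq : ∀ (n : ℕ) (w : Word c₁ c₂ T n),
      μq (cyl c₁ c₂ T n w) =
        ENNReal.ofReal (cylWeight c₁ c₂ T (taW c₁ a q) (taW c₂ b q) n w))
    (ε : ℝ) (hε : 0 < ε) :
    ∀ᵐ x ∂(μq.map (gammaMap c₁ c₂ T)),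
      ∃ rx : ℝ, 0 < rx ∧ ∀ r : ℝ, 0 < r → r < rx →
        μq.map (gammaMap c₁ c₂ T) (closedBall x r) ≤
          μ.map (gammaMap c₁ c₂ T) (closedBall x r) ^ q *
            ENNReal.ofReal r ^ (Filter.liminf (tauN c₁ c₂ T a b q) atTop - ε) := by
  have ha' : ∀ i < c₁, 0 < a i := fun i hi => (ha i hi).1
  have hb' : ∀ i < c₂, 0 < b i := fun i hi => (hb i hi).1
  have hY := two_le_Yc hc₁ hc₂ T
  have hM : ∀ n, (Yc c₁ c₂ T n : ℝ) ≤ (max c₁ c₂ : ℕ) := fun n => by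
    rw [Yc]
    split_ifs
    · exact_mod_cast le_max_left c₁ c₂
    · exact_mod_cast le_max_right c₁ c₂
  obtain ⟨δ₁, hδ₁, hδa⟩ := exists_pos_forall_le hc₁ ha'
  obtain ⟨δ₂, hδ₂, hδb⟩ := exists_pos_forall_le hc₂ hb'
  obtain ⟨ρ₁, hρ₁, hρa⟩ := exists_pos_forall_le hc₁ (a := fun i => 1 - taW c₁ a q i)
    fun i hi => sub_pos.2 (taW_lt_one hc₁ ha' q i hi)
  obtain ⟨ρ₂, hρ₂, hρb⟩ := exists_pos_forall_le hc₂ (a := fun i => 1 - taW c₂ b q i)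
    fun i hi => sub_pos.2 (taW_lt_one hc₂ hb' q i hi)
  have hρ : min ρ₁ ρ₂ < 1 := (min_le_left _ _).trans_lt
    ((hρa 0 (by omega)).trans_lt (sub_lt_self 1 (taW_pos hc₁ ha' q 0 (by omega))))
  have hexp : liminf (tauN c₁ c₂ T a b q) atTop - ε =
      liminf (tauN c₁ c₂ T a b q) atTop - ε / 2 - ε / 2 := by ring
  rw [gammaMap_eq_ofMixedDigits, hexp]
  refine ae_map_closedBall_le hY hM (p := mixedWeight T a b)
    (pq := mixedWeight T (taW c₁ a q) (taW c₂ b q)) (δ := min δ₁ δ₂) (ρ := 1 - min ρ₁ ρ₂)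
    (lt_min hδ₁ hδ₂)
    ((min_le_left _ _).trans ((hδa 0 (by omega)).trans (ha 0 (by omega)).2.le))
    (mixedWeight_forall (P := (min δ₁ δ₂ ≤ ·)) (fun i hi => (min_le_left _ _).trans (hδa i hi))
      fun i hi => (min_le_right _ _).trans (hδb i hi))
    (sub_pos.2 hρ) (sub_lt_self 1 (lt_min hρ₁ hρ₂))
    (mixedWeight_forall (P := (0 ≤ ·)) (fun i hi => (taW_pos hc₁ ha' q i hi).le)
      fun i hi => (taW_pos hc₂ hb' q i hi).le)
    (mixedWeight_forall (P := (· ≤ 1 - min ρ₁ ρ₂))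
      (fun i hi => by linarith [hρa i hi, min_le_left ρ₁ ρ₂])
      fun i hi => by linarith [hρb i hi, min_le_right ρ₁ ρ₂])
    (fun n => ?_) μ μq (measure_cylAt_of_cyl μ hμ) (measure_cylAt_of_cyl μq hμq) (half_pos hε) ?_
  · simp only [mixedWeight, Yc]
    split_ifs
    · exact sum_taW hc₁ ha' q
    · exact sum_taW hc₂ hb' q
  · filter_upwards [eventually_inv_partition_le hc₁ hc₂ T ha' hb' q
      (sub_lt_self (liminf (tauN c₁ c₂ T a b q) atTop) (half_pos hε))] with m hm x
    rw [prodWeight_taW ha' hb', div_eq_mul_inv]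
    exact mul_le_mul_of_nonneg_left hm (Real.rpow_nonneg (prodWeight_pos
      (mixedWeight_forall (P := (0 < ·)) ha' hb') m x).le q)

end MF
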